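/- Assume the quantitative prime K-tuples conjecture (for admissible sets of linear forms L_k(n) = a_k n + b_k with a_k, b_k ≤ (log log x)^100 and K ≤ 100 log log log x, the count of n ≤ x making all L_k(n) prime is (1+o(1))·𝔖(𝓛)·x/(log x)^K). Then for every integer t ≥ 2, the number ∑_{n≥1} ω(n)/t^n is irrational. -/

import Mathlib

lemma two_pow_omega_le {m : ℕ} (hm : m ≠ 0) :
    2 ^ m.primeFactors.card ≤ m.divisors.card := by
  rw [Nat.card_divisors hm, ← Finset.prod_const]
  refine Finset.prod_le_prod' fun p hp => ?_
  have := (Nat.Prime.factorization_pos_of_dvd (Nat.prime_of_mem_primeFactors hp) hm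
    (Nat.dvd_of_mem_primeFactors hp))
  omega

lemma two_pow_omega_le_self {m : ℕ} (hm : m ≠ 0) :
    2 ^ m.primeFactors.card ≤ m :=
  (two_pow_omega_le hm).trans (Nat.card_divisors_le_self m)

lemma omega_le_self (m : ℕ) : m.primeFactors.card ≤ m := by
  rcases eq_or_ne m 0 with rfl | hm
  · simp
  · exact (Nat.lt_two_pow_self.le).trans (two_pow_omega_le_self hm)

lemma count_omega (Y V : ℕ) :
    (((Finset.Ioc 0 Y).filter fun m => V ≤ m.primeFactors.card).card : ℝ) * 2 ^ V
      ≤ Y * (1 + Real.log Y) := by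
  have h1 : ((Finset.Ioc 0 Y).filter fun m => V ≤ m.primeFactors.card).card * 2 ^ V
      ≤ ∑ n ∈ Finset.Ioc 0 Y, (Y / n) := by
    rw [← ArithmeticFunction.sum_Ioc_sigma0_eq_sum_div, ← smul_eq_mul]
    refine (Finset.card_nsmul_le_sum _ (fun n => ArithmeticFunction.sigma 0 n) _ ?_).trans
      (Finset.sum_le_sum_of_subset (Finset.filter_subset _ _))
    intro m hm
    simp only [Finset.mem_filter, Finset.mem_Ioc] at hm
    rw [ArithmeticFunction.sigma_zero_apply]
    exact (Nat.pow_le_pow_right (by norm_num) hm.2).trans (two_pow_omega_le (by omega))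
  have h2 : (∑ n ∈ Finset.Ioc 0 Y, ((Y / n : ℕ) : ℝ)) ≤ Y * (harmonic Y : ℝ) := by
    rw [harmonic_eq_sum_Icc]
    push_cast
    rw [Finset.mul_sum]
    refine Finset.sum_le_sum_of_subset_of_nonneg ?_ ?_ |>.trans' (Finset.sum_le_sum
      (f := fun n => ((Y / n : ℕ) : ℝ)) (g := fun n : ℕ => (Y : ℝ) * (n : ℝ)⁻¹) ?_)
    · intro a; simp; omega
    · intros; positivity
    · intro i _
      exact (Nat.cast_div_le).trans (by rw [div_eq_mul_inv])
  calc _ = ((((Finset.Ioc 0 Y).filter fun m => V ≤ m.primeFactors.card).card * 2 ^ V : ℕ) : ℝ) := by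
        push_cast; rfl
    _ ≤ ((∑ n ∈ Finset.Ioc 0 Y, (Y / n) : ℕ) : ℝ) := by exact_mod_cast h1
    _ ≤ Y * (harmonic Y : ℝ) := by push_cast; exact h2
    _ ≤ _ := by gcongr; exact harmonic_le_one_add_log Y

lemma prod_one_sub_ge {ι : Type*} [DecidableEq ι] (s : Finset ι) (f : ι → ℝ)
    (h0 : ∀ i ∈ s, 0 ≤ f i) (h1 : ∀ i ∈ s, f i ≤ 1) :
    1 - ∑ i ∈ s, f i ≤ ∏ i ∈ s, (1 - f i) ∧ ∏ i ∈ s, (1 - f i) ≤ 1 := by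
  induction s using Finset.induction_on with
  | empty => simp
  | insert a s ha ih =>
    rw [Finset.sum_insert ha, Finset.prod_insert ha]
    obtain ⟨i1, i2⟩ := ih (fun i hi => h0 i (Finset.mem_insert_of_mem hi))
      (fun i hi => h1 i (Finset.mem_insert_of_mem hi))
    have a0 := h0 a (Finset.mem_insert_self _ _)
    have a1 := h1 a (Finset.mem_insert_self _ _)
    have : 0 ≤ ∏ i ∈ s, (1 - f i) := Finset.prod_nonneg fun i hi => by
      have := h1 i (Finset.mem_insert_of_mem hi); linarith
    constructor <;> nlinarith

lemma singular_factor_small {p w K : ℕ} (hp : p.Prime) (hw : w < p) :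
    (1 : ℝ) / p ≤ (1 - (w : ℝ) / p) * ((1 - 1 / (p : ℝ))⁻¹) ^ K := by
  have hp0 : (0 : ℝ) < p := by exact_mod_cast hp.pos
  have hp1 : (1 : ℝ) < p := by exact_mod_cast hp.one_lt
  have h1 : (1 : ℝ) / p ≤ 1 - (w : ℝ) / p := by
    have : (w : ℝ) + 1 ≤ p := by exact_mod_cast hw
    rw [le_sub_iff_add_le, ← add_div, div_le_one hp0]; linarith
  have h3 : (1 : ℝ) / p < 1 := by rw [div_lt_one hp0]; exact hp1
  have h2 : 1 ≤ ((1 - 1 / (p : ℝ))⁻¹) ^ K := by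
    apply one_le_pow₀
    apply (one_le_inv₀ (by linarith)).2
    have : 0 ≤ 1 / (p : ℝ) := by positivity
    linarith
  have h4 : 0 ≤ 1 / (p : ℝ) := by positivity
  nlinarith

lemma singular_factor_large {p w K : ℕ} (hp : p.Prime) (hw : w ≤ K) (hK : K < p) :
    1 - (K : ℝ) ^ 2 * ((p : ℝ) ^ 2)⁻¹ ≤ (1 - (w : ℝ) / p) * ((1 - 1 / (p : ℝ))⁻¹) ^ K := by
  have hp0 : (0 : ℝ) < p := by exact_mod_cast hp.pos
  have hp1 : (1 : ℝ) < p := by exact_mod_cast hp.one_lt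
  have h3 : (1 : ℝ) / p < 1 := by rw [div_lt_one hp0]; exact hp1
  have h4 : 0 ≤ 1 / (p : ℝ) := by positivity
  have h5 : 1 + 1 / (p : ℝ) ≤ (1 - 1 / (p : ℝ))⁻¹ := by
    rw [le_inv_comm₀ (by linarith) (by linarith), inv_eq_one_div, le_div_iff₀ (by linarith)]
    nlinarith
  have h6 : 1 + (K : ℝ) * (1 / p) ≤ ((1 - 1 / (p : ℝ))⁻¹) ^ K :=
    (one_add_mul_le_pow (by linarith) K).trans (pow_le_pow_left₀ (by linarith) h5 K)
  have h7 : 1 - (K : ℝ) / p ≤ 1 - (w : ℝ) / p := by gcongr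
  have h8 : (K : ℝ) / p ≤ 1 := by rw [div_le_one hp0]; exact_mod_cast hK.le
  calc _ = (1 - (K : ℝ) / p) * (1 + (K : ℝ) * (1 / p)) := by field_simp; ring
    _ ≤ _ := mul_le_mul h7 h6 (by positivity) (by linarith)

lemma singular_finite (K : ℕ) (hK : 1 ≤ K) (w : ℕ → ℕ) (hw : ∀ p, p.Prime → w p < p)
    (hwK : ∀ p, p.Prime → w p ≤ K) (s : Finset {p : ℕ // p.Prime}) :
    (1 / 2 : ℝ) * (1 / ((2 * K ^ 2 : ℕ) : ℝ)) ^ (2 * K ^ 2) ≤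
      ∏ p ∈ s, (1 - (w p : ℝ) / (p : ℕ)) * ((1 - 1 / ((p : ℕ) : ℝ))⁻¹) ^ K := by
  classical
  set P := 2 * K ^ 2 with hP
  have hP1 : 1 ≤ P := by nlinarith [Nat.pow_le_pow_left hK 2]
  have hPK : K ≤ P := by nlinarith
  have hPr : (1 : ℝ) ≤ P := by exact_mod_cast hP1
  rw [← Finset.prod_filter_mul_prod_filter_not s (fun p : {p : ℕ // p.Prime} => (p : ℕ) ≤ P), mul_comm]
  have hi : (1 : ℝ) / P ≤ 1 := by rw [div_le_one (by linarith)]; exact hPr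
  have hi0 : (0 : ℝ) ≤ 1 / P := by positivity
  have A : (1 / (P : ℝ)) ^ P ≤ ∏ p ∈ s.filter (fun p : {p : ℕ // p.Prime} => (p : ℕ) ≤ P),
      (1 - (w p : ℝ) / (p : ℕ)) * ((1 - 1 / ((p : ℕ) : ℝ))⁻¹) ^ K := by
    have hc : (s.filter (fun p : {p : ℕ // p.Prime} => (p : ℕ) ≤ P)).card ≤ P := by
      have : ((s.filter (fun p : {p : ℕ // p.Prime} => (p : ℕ) ≤ P)).image Subtype.val) ⊆ Finset.Icc 1 P := by
        intro a ha
        simp only [Finset.mem_image, Finset.mem_filter] at ha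
        obtain ⟨p, ⟨_, h⟩, rfl⟩ := ha
        exact Finset.mem_Icc.2 ⟨p.2.one_lt.le, h⟩
      have := Finset.card_le_card this
      rwa [Finset.card_image_of_injective _ Subtype.val_injective, Nat.card_Icc,
        Nat.add_sub_cancel] at this
    refine (pow_le_pow_of_le_one hi0 hi hc).trans ?_
    rw [← Finset.prod_const]
    refine Finset.prod_le_prod (fun _ _ => hi0) fun p hp => ?_
    refine le_trans ?_ (singular_factor_small p.2 (hw p p.2))
    have hp' : ((p : ℕ) : ℝ) ≤ P := by exact_mod_cast (Finset.mem_filter.1 hp).2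
    exact one_div_le_one_div_of_le (by exact_mod_cast p.2.pos) hp'
  have B : (1 / 2 : ℝ) ≤ ∏ p ∈ s.filter (fun p : {p : ℕ // p.Prime} => ¬ (p : ℕ) ≤ P),
      (1 - (w p : ℝ) / (p : ℕ)) * ((1 - 1 / ((p : ℕ) : ℝ))⁻¹) ^ K := by
    set s' := s.filter (fun p : {p : ℕ // p.Prime} => ¬ (p : ℕ) ≤ P) with hs'
    have hlt : ∀ p ∈ s', P < (p : ℕ) := fun p hp => not_le.1 (Finset.mem_filter.1 hp).2
    have hle1 : ∀ p ∈ s', (K : ℝ) ^ 2 * (((p : ℕ) : ℝ) ^ 2)⁻¹ ≤ 1 := by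
      intro p hp
      have h1 := hlt p hp
      have h2 : (K : ℝ) ≤ (p : ℕ) := by exact_mod_cast hPK.trans h1.le
      have h3 : (0 : ℝ) < (p : ℕ) := by exact_mod_cast p.2.pos
      rw [← div_eq_mul_inv, div_le_one (by positivity)]
      gcongr
    have key := (prod_one_sub_ge s' (fun p : {p : ℕ // p.Prime} => (K : ℝ) ^ 2 * (((p : ℕ) : ℝ) ^ 2)⁻¹)
      (fun _ _ => by positivity) hle1).1
    have hsum : ∑ p ∈ s', (K : ℝ) ^ 2 * (((p : ℕ) : ℝ) ^ 2)⁻¹ ≤ 1 / 2 := by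
      rw [← Finset.mul_sum]
      have h1 : ∑ p ∈ s', (((p : ℕ) : ℝ) ^ 2)⁻¹ ≤ (P : ℝ)⁻¹ := by
        obtain ⟨M, hM⟩ : ∃ M, ∀ a ∈ s'.image Subtype.val, a ≤ M :=
          ⟨(s'.image Subtype.val).sup id, fun a ha => Finset.le_sup (f := id) ha⟩
        have h2 : ∑ p ∈ s', (((p : ℕ) : ℝ) ^ 2)⁻¹ =
            ∑ a ∈ s'.image Subtype.val, ((a : ℝ) ^ 2)⁻¹ := by
          rw [Finset.sum_image (fun _ _ _ _ h => Subtype.val_injective h)]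
        rw [h2]
        have h3 : s'.image Subtype.val ⊆ Finset.Ioc P (max P M) := by
          intro a ha
          refine Finset.mem_Ioc.2 ⟨?_, (hM a ha).trans (le_max_right _ _)⟩
          obtain ⟨p, hp, rfl⟩ := Finset.mem_image.1 ha
          exact hlt p hp
        refine (Finset.sum_le_sum_of_subset_of_nonneg h3 (fun _ _ _ => by positivity)).trans ?_
        refine (sum_Ioc_inv_sq_le_sub (by omega) (le_max_left _ _)).trans ?_
        have : (0 : ℝ) ≤ ((max P M : ℕ) : ℝ)⁻¹ := by positivity
        linarith
      have hK0 : (0 : ℝ) < K := by exact_mod_cast hK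
      calc (K : ℝ) ^ 2 * _ ≤ (K : ℝ) ^ 2 * (P : ℝ)⁻¹ := by gcongr
        _ = 1 / 2 := by rw [hP]; push_cast; field_simp
    refine (by linarith : (1 / 2 : ℝ) ≤ _).trans (key.trans ?_)
    refine Finset.prod_le_prod (fun p hp => by linarith [hle1 p hp]) fun p hp => ?_
    exact singular_factor_large p.2 (hwK p p.2) (hPK.trans_lt (hlt p hp))
  rw [mul_comm]
  rw [mul_comm (1 / 2 : ℝ)]
  exact mul_le_mul A B (by norm_num) ((pow_nonneg hi0 _).trans A)

lemma singular_tprod (K : ℕ) (hK : 1 ≤ K) (w : ℕ → ℕ) (hw : ∀ p, p.Prime → w p < p)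
    (hwK : ∀ p, p.Prime → w p ≤ K) :
    (1 / 2 : ℝ) * (1 / ((2 * K ^ 2 : ℕ) : ℝ)) ^ (2 * K ^ 2) ≤
      ∏' p : {p : ℕ // p.Prime}, (1 - (w p : ℝ) / (p : ℕ)) * ((1 - 1 / ((p : ℕ) : ℝ))⁻¹) ^ K := by
  by_cases hm : Multipliable (fun p : {p : ℕ // p.Prime} =>
      (1 - (w p : ℝ) / (p : ℕ)) * ((1 - 1 / ((p : ℕ) : ℝ))⁻¹) ^ K)
  · exact ge_of_tendsto hm.hasProd (Filter.Eventually.of_forall fun s =>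
      singular_finite K hK w hw hwK s)
  · rw [tprod_eq_one_of_not_multipliable hm]
    simpa using singular_finite K hK w hw hwK ∅

lemma root_count_le {p K : ℕ} (hp : p.Prime) (a b : Fin K → ℕ)
    (h : {n : ZMod p | ∏ k, ((a k : ZMod p) * n + (b k : ZMod p)) = 0}.ncard < p) :
    {n : ZMod p | ∏ k, ((a k : ZMod p) * n + (b k : ZMod p)) = 0}.ncard ≤ K := by
  have := Fact.mk hp
  obtain ⟨n₀, hn₀⟩ : ∃ n : ZMod p, ∏ k, ((a k : ZMod p) * n + (b k : ZMod p)) ≠ 0 := by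
    by_contra! hc
    have : {n : ZMod p | ∏ k, ((a k : ZMod p) * n + (b k : ZMod p)) = 0} = Set.univ :=
      Set.eq_univ_of_forall hc
    rw [this, Set.ncard_univ, Nat.card_zmod] at h
    exact lt_irrefl _ h
  have hsub : {n : ZMod p | ∏ k, ((a k : ZMod p) * n + (b k : ZMod p)) = 0} ⊆
      Set.range (fun k => -(b k : ZMod p) * (a k : ZMod p)⁻¹) := by
    intro n hn
    obtain ⟨k, _, hk⟩ := Finset.prod_eq_zero_iff.1 (show ∏ k, _ = _ from hn)
    refine ⟨k, ?_⟩
    have ha : (a k : ZMod p) ≠ 0 := by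
      intro ha
      rw [ha, zero_mul, zero_add] at hk
      exact hn₀ (Finset.prod_eq_zero (Finset.mem_univ k) (by rw [ha, hk]; simp))
    simp only
    field_simp
    linear_combination -hk
  refine (Set.ncard_le_ncard hsub (Set.toFinite _)).trans ?_
  rw [← Set.image_univ]
  refine (Set.ncard_image_le (Set.toFinite _)).trans ?_
  simp [Set.ncard_univ]

lemma omega_mul_prime {h p : ℕ} (hh : 1 ≤ h) (hp : p.Prime) (hlt : h < p) :
    (h * p).primeFactors.card = h.primeFactors.card + 1 := by
  have hc : h.Coprime p := ((hp.coprime_iff_not_dvd).2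
    (Nat.not_dvd_of_pos_of_lt hh hlt)).symm
  rw [hc.primeFactors_mul, Finset.card_union_of_disjoint hc.disjoint_primeFactors,
    hp.primeFactors, Finset.card_singleton]

lemma construction (H h₀ : ℕ) (h1 : 1 ≤ h₀) (h2 : h₀ ≤ H) :
    ∃ (Q q r : ℕ) (a b : Fin H → ℕ), 1 ≤ Q ∧ 1 ≤ q ∧ (Q : ℝ) ≤ Real.exp (6 * H) ∧ q ≤ 2 * H ∧
      r ≤ q ^ 2 + q ∧ (∀ k, 0 < a k) ∧ (∀ k, 0 < b k) ∧
      Function.Injective (fun k => (a k, b k)) ∧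
      (∀ p : ℕ, p.Prime →
          {n : ZMod p | ∏ k, ((a k : ZMod p) * n + (b k : ZMod p)) = 0}.ncard < p) ∧
      (∀ k, a k ≤ Q * (q + r)) ∧ (∀ k, b k ≤ Q * (q + r)) ∧
      ∀ n, 1 ≤ n → (∀ k, Nat.Prime (a k * n + b k)) → ∀ h, 1 ≤ h → h ≤ H →
        (Q * (q * n + r) + h).primeFactors.card =
          h.primeFactors.card + 1 + if h = h₀ then 1 else 0 := by
  obtain ⟨q, hq, hHq, hq2⟩ := Nat.exists_prime_lt_and_le_two_mul H (by omega)
  have : Fact q.Prime := ⟨hq⟩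
  set Q := Nat.lcmUpto H with hQ
  have hQ0 : 0 < Q := Nat.lcmUpto_pos H
  have hdvd : ∀ h, 1 ≤ h → h ≤ H → h ∣ Q := fun h a b =>
    Finset.dvd_lcm (f := id) (Finset.mem_Icc.2 ⟨a, b⟩)
  have hqQ : ¬ q ∣ Q := by
    intro hd
    have := hd.trans (Nat.lcmUpto_dvd_factorial H)
    rw [hq.dvd_factorial] at this
    omega
  have hqQ' : (Q : ZMod q) ≠ 0 := by rwa [Ne, ZMod.natCast_eq_zero_iff]
  have hqh : ∀ h, 1 ≤ h → h ≤ H → ¬ q ∣ h := fun h a b =>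
    Nat.not_dvd_of_pos_of_lt a (by omega)
  have hQle : (Q : ℝ) ≤ Real.exp (6 * H) := by
    have e1 := Chebyshev.psi_eq_log_lcmUpto H
    have e2 := Chebyshev.psi_le_const_mul_self (x := (H : ℝ)) (by positivity)
    have e3 : Real.log 4 ≤ 2 := by
      rw [show (4 : ℝ) = 2 ^ 2 by norm_num, Real.log_pow]
      have := Real.log_two_lt_d9
      norm_num; linarith
    rw [← Real.log_le_iff_le_exp (by exact_mod_cast hQ0), ← e1]
    refine e2.trans ?_
    gcongr; linarith
  set r₀ := (-(h₀ : ZMod q) * (Q : ZMod q)⁻¹).val with hr₀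
  have hr₀lt : r₀ < q := ZMod.val_lt _
  set r := r₀ + q ^ 2 with hr
  have hqr : ((Q * r + h₀ : ℕ) : ZMod q) = 0 := by
    rw [hr]; push_cast
    rw [hr₀, ZMod.natCast_val, ZMod.cast_id]
    simp only [CharP.cast_eq_zero]
    field_simp
    ring
  have hrpos : q ^ 2 ≤ r := by omega
  have hq1 := hq.one_lt
  -- cofactors
  have hQh : ∀ k : Fin H, ((k : ℕ) + 1) * (Q / ((k : ℕ) + 1)) = Q := fun k =>
    Nat.mul_div_cancel' (hdvd _ (by omega) (by omega))
  have hQhpos : ∀ k : Fin H, 0 < Q / ((k : ℕ) + 1) := fun k =>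
    Nat.pos_of_ne_zero fun h => by have := hQh k; rw [h] at this; omega
  have hQhle : ∀ k : Fin H, Q / ((k : ℕ) + 1) ≤ Q := fun k => Nat.div_le_self _ _
  have hab : ∀ k : Fin H, ∃ e a b : ℕ, e = (if (k : ℕ) + 1 = h₀ then q else 1) ∧
      e * a = Q / ((k : ℕ) + 1) * q ∧ e * b = Q / ((k : ℕ) + 1) * r + 1 := by
    intro k
    by_cases hk : (k : ℕ) + 1 = h₀
    · have hd : q ∣ Q / ((k : ℕ) + 1) * r + 1 := by
        have h3 : q ∣ ((k : ℕ) + 1) * (Q / ((k : ℕ) + 1) * r + 1) := by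
          have : ((k : ℕ) + 1) * (Q / ((k : ℕ) + 1) * r + 1) = Q * r + h₀ := by
            rw [mul_add, ← mul_assoc, hQh k, mul_one, hk]
          rw [this]
          exact (ZMod.natCast_eq_zero_iff _ _).1 hqr
        exact (hq.dvd_mul.1 h3).resolve_left (hqh _ (by omega) (by omega))
      obtain ⟨b, hb⟩ := hd
      exact ⟨q, Q / ((k : ℕ) + 1), b, by rw [if_pos hk], by ring, hb.symm⟩
    · exact ⟨1, Q / ((k : ℕ) + 1) * q, Q / ((k : ℕ) + 1) * r + 1, by rw [if_neg hk], by ring,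
        by ring⟩
  choose e a b he ha hb using hab
  have hepos : ∀ k, 0 < e k := by
    intro k; rw [he]; split_ifs <;> omega
  have hapos : ∀ k, 0 < a k := by
    intro k
    refine Nat.pos_of_ne_zero fun h => ?_
    have h3 := ha k
    rw [h, mul_zero] at h3
    have := Nat.mul_pos (hQhpos k) hq.pos
    omega
  have hbpos : ∀ k, 0 < b k := by
    intro k
    refine Nat.pos_of_ne_zero fun h => ?_
    have h3 := hb k
    rw [h, mul_zero] at h3
    omega
  have hale : ∀ k, a k ≤ Q / ((k : ℕ) + 1) * q := fun k => by
    rw [← ha]; exact Nat.le_mul_of_pos_left _ (hepos k)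
  have hble : ∀ k, b k ≤ Q / ((k : ℕ) + 1) * r + 1 := fun k => by
    rw [← hb]; exact Nat.le_mul_of_pos_left _ (hepos k)
  refine ⟨Q, q, r, a, b, hQ0, hq.pos, hQle, hq2, by omega, hapos, hbpos, ?_, ?_, ?_, ?_, ?_⟩
  · -- injectivity
    intro k l hkl
    have hakl : a k = a l := (Prod.mk.inj hkl).1
    -- (k+1) e_k a_k = Q q
    have hk : ((k : ℕ) + 1) * (e k) * a k = Q * q := by
      rw [mul_assoc, ha, ← mul_assoc, hQh]
    have hl : ((l : ℕ) + 1) * (e l) * a l = Q * q := by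
      rw [mul_assoc, ha, ← mul_assoc, hQh]
    rw [← hl, hakl] at hk
    have h3 := Nat.eq_of_mul_eq_mul_right (hapos l) hk
    rw [he, he] at h3
    have hk' := k.2
    have hl' := l.2
    apply Fin.ext
    split_ifs at h3 with c1 c2 c2
    · omega
    · exfalso
      exact hqh ((l : ℕ) + 1) (by omega) (by omega) ⟨(k : ℕ) + 1, by rw [mul_comm q]; omega⟩
    · exfalso
      exact hqh ((k : ℕ) + 1) (by omega) (by omega) ⟨(l : ℕ) + 1, by rw [mul_comm q]; omega⟩
    · omega
  · -- admissibility
    intro p hp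
    have : Fact p.Prime := ⟨hp⟩
    suffices hs : ∃ n : ZMod p, ∀ k, (a k : ZMod p) * n + (b k : ZMod p) ≠ 0 by
      obtain ⟨n, hn⟩ := hs
      have hne : {n : ZMod p | ∏ k, ((a k : ZMod p) * n + (b k : ZMod p)) = 0} ≠ Set.univ := by
        intro h
        have : n ∈ {n : ZMod p | ∏ k, ((a k : ZMod p) * n + (b k : ZMod p)) = 0} := by
          rw [h]; trivial
        exact Finset.prod_ne_zero_iff.2 (fun k _ => hn k) this
      simpa using Set.ncard_lt_card hne
    have haZ : ∀ k, (e k : ZMod p) * a k = ((Q / ((k : ℕ) + 1) : ℕ) : ZMod p) * q := fun k => by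
      exact_mod_cast congrArg (Nat.cast (R := ZMod p)) (ha k)
    have hbZ : ∀ k, (e k : ZMod p) * b k = ((Q / ((k : ℕ) + 1) : ℕ) : ZMod p) * r + 1 := fun k => by
      exact_mod_cast congrArg (Nat.cast (R := ZMod p)) (hb k)
    by_cases hpq : p = q
    · subst hpq
      have hpz : ((p : ℕ) : ZMod p) = 0 := by simp
      -- choose n such that the form at h₀ equals one
      set k₀ : Fin H := ⟨h₀ - 1, by omega⟩ with hk₀
      have hk₀' : (k₀ : ℕ) + 1 = h₀ := by simp [hk₀]; omega
      have hak₀ : (a k₀ : ZMod p) ≠ 0 := by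
        have h3 := ha k₀
        rw [he, if_pos hk₀', mul_comm] at h3
        have h4 := Nat.eq_of_mul_eq_mul_right hq.pos h3
        rw [h4]
        intro h5
        apply hqQ'
        have := congrArg (Nat.cast (R := ZMod p)) (hQh k₀)
        push_cast at this
        rw [← this, h5, mul_zero]
      refine ⟨(1 - b k₀) * (a k₀ : ZMod p)⁻¹, fun k => ?_⟩
      by_cases hk : (k : ℕ) + 1 = h₀
      · have : k = k₀ := Fin.ext (by omega)
        rw [this]
        have : (a k₀ : ZMod p) * ((1 - b k₀) * (a k₀ : ZMod p)⁻¹) + b k₀ = 1 := by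
          field_simp; ring
        rw [this]; exact one_ne_zero
      · have e1 : e k = 1 := by rw [he, if_neg hk]
        have h3 := haZ k
        have h4 := hbZ k
        rw [e1, Nat.cast_one, one_mul] at h3 h4
        rw [h3, h4, hpz, mul_zero, zero_mul, zero_add]
        intro h5
        have h6 := congrArg (Nat.cast (R := ZMod p)) (hQh k)
        have h7 : ((h₀ : ℕ) : ZMod p) = (((k : ℕ) + 1 : ℕ) : ZMod p) := by
          push_cast at hqr h6 ⊢
          linear_combination hqr - ((k : ZMod p) + 1) * h5 + r * h6
        rw [ZMod.natCast_eq_natCast_iff'] at h7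
        have hk2 := k.2
        rw [Nat.mod_eq_of_lt (by omega), Nat.mod_eq_of_lt (by omega)] at h7
        exact hk h7.symm
    · have hqp : (q : ZMod p) ≠ 0 := by
        rw [Ne, ZMod.natCast_eq_zero_iff]
        intro h
        exact hpq ((Nat.prime_dvd_prime_iff_eq hp hq).1 h)
      refine ⟨-(r : ZMod p) * (q : ZMod p)⁻¹, fun k hk => ?_⟩
      have h3 : (e k : ZMod p) * ((a k : ZMod p) * (-(r : ZMod p) * (q : ZMod p)⁻¹) + b k) = 1 := by
        rw [mul_add, ← mul_assoc, haZ, hbZ]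
        field_simp
        ring
      rw [hk, mul_zero] at h3
      exact zero_ne_one h3
  · intro k
    refine (hale k).trans ?_
    exact Nat.mul_le_mul (hQhle k) (by omega)
  · intro k
    refine (hble k).trans ?_
    have := Nat.mul_le_mul (hQhle k) (le_refl r)
    nlinarith
  · intro n hn hpr h hh1 hhH
    set k : Fin H := ⟨h - 1, by omega⟩ with hk
    have hk' : (k : ℕ) + 1 = h := by simp [hk]; omega
    have hform : h * (e k * (a k * n + b k)) = Q * (q * n + r) + h := by
      have h3 : e k * (a k * n + b k) = Q / ((k : ℕ) + 1) * (q * n + r) + 1 := by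
        linear_combination n * ha k + hb k
      rw [h3]
      have h4 := hQh k
      rw [hk'] at h4 ⊢
      linear_combination (q * n + r) * h4
    rw [← hform]
    have hp := hpr k
    by_cases hc : h = h₀
    · rw [if_pos hc]
      have e1 : e k = q := by rw [he, if_pos (by omega)]
      rw [e1]
      have hbq : q < b k := by
        have h3 := hb k
        rw [e1] at h3
        by_contra hcon
        push Not at hcon
        have h5 : q * b k ≤ q * q := Nat.mul_le_mul_left _ hcon
        have h6 : r ≤ Q / ((k : ℕ) + 1) * r := Nat.le_mul_of_pos_left _ (hQhpos k)
        nlinarith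
      have hlt : q < a k * n + b k := by omega
      have hcop : h.Coprime (q * (a k * n + b k)) := by
        apply Nat.Coprime.mul_right
        · exact ((hq.coprime_iff_not_dvd).2 (Nat.not_dvd_of_pos_of_lt hh1 (by omega))).symm
        · exact ((hp.coprime_iff_not_dvd).2 (Nat.not_dvd_of_pos_of_lt hh1 (by omega))).symm
      rw [hcop.primeFactors_mul, Finset.card_union_of_disjoint hcop.disjoint_primeFactors,
        omega_mul_prime hq.pos hp hlt, hq.primeFactors, Finset.card_singleton]
    · rw [if_neg hc]
      have e1 : e k = 1 := by rw [he, if_neg (by omega)]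
      rw [e1, one_mul, omega_mul_prime hh1 hp]
      have h3 := ha k
      rw [e1, one_mul] at h3
      have h4 : q ≤ a k := by rw [h3]; exact Nat.le_mul_of_pos_left _ (hQhpos k)
      have h5 : a k ≤ a k * n := Nat.le_mul_of_pos_right _ hn
      omega

lemma good_of_count (Y Q q r V : ℕ) (S : Finset ℕ) (hS : S ⊆ Finset.Icc 1 Y)
    (hQ : 1 ≤ Q) (hq : 1 ≤ q)
    (hT : ((2 * (Q * (q * Y + r)) : ℕ) : ℝ) * (1 + Real.log ((2 * (Q * (q * Y + r)) : ℕ) : ℝ))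
      < (S.card : ℝ) * 2 ^ V) :
    ∃ n ∈ S, ∀ h, 1 ≤ h → (Q * (q * n + r) + h).primeFactors.card ≤ V + h := by
  by_contra! hcon
  set X := Q * (q * Y + r) with hX
  set T : ℝ := ((2 * X : ℕ) : ℝ) * (1 + Real.log ((2 * X : ℕ) : ℝ)) with hTdef
  have hT0 : 0 ≤ T := by
    have : 0 ≤ Real.log ((2 * X : ℕ) : ℝ) := Real.log_natCast_nonneg _
    positivity
  have hNX : ∀ n ∈ S, Q * (q * n + r) ≤ X := by
    intro n hn
    have := (Finset.mem_Icc.1 (hS hn)).2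
    rw [hX]; gcongr
  have hcover : S ⊆ (Finset.Icc 1 X).biUnion fun h =>
      S.filter fun n => V + h ≤ (Q * (q * n + r) + h).primeFactors.card := by
    intro n hn
    obtain ⟨h, h1, h2⟩ := hcon n hn
    rw [Finset.mem_biUnion]
    refine ⟨h, Finset.mem_Icc.2 ⟨h1, ?_⟩, Finset.mem_filter.2 ⟨hn, h2.le⟩⟩
    by_contra! hlt
    have h3 : 2 ^ (Q * (q * n + r) + h).primeFactors.card ≤ Q * (q * n + r) + h :=
      two_pow_omega_le_self (by omega)
    have h4 : 2 ^ (h + 1) ≤ 2 ^ (Q * (q * n + r) + h).primeFactors.card :=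
      Nat.pow_le_pow_right (by norm_num) (by omega)
    have h5 := hNX n hn
    have h6 : h < 2 ^ h := Nat.lt_two_pow_self
    rw [pow_succ] at h4
    omega
  have hpiece : ∀ h ∈ Finset.Icc 1 X,
      ((S.filter fun n => V + h ≤ (Q * (q * n + r) + h).primeFactors.card).card : ℝ)
        ≤ T / 2 ^ V * (1 / 2) ^ h := by
    intro h hh
    rw [Finset.mem_Icc] at hh
    have h1 : (S.filter fun n => V + h ≤ (Q * (q * n + r) + h).primeFactors.card).card ≤
        ((Finset.Ioc 0 (2 * X)).filter fun m => V + h ≤ m.primeFactors.card).card := by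
      refine Finset.card_le_card_of_injOn (fun n => Q * (q * n + r) + h) ?_ ?_
      · intro n hn
        have hn' := Finset.mem_filter.1 hn
        have := hNX n hn'.1
        refine Finset.mem_filter.2 ⟨Finset.mem_Ioc.2 ⟨?_, ?_⟩, hn'.2⟩
        · show 0 < Q * (q * n + r) + h
          omega
        · show Q * (q * n + r) + h ≤ _
          omega
      · intro n _ m _ hnm
        have h2 : Q * (q * n + r) = Q * (q * m + r) := Nat.add_right_cancel hnm
        have h3 := Nat.eq_of_mul_eq_mul_left hQ h2
        exact Nat.eq_of_mul_eq_mul_left hq (Nat.add_right_cancel h3)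
    have h2 := count_omega (2 * X) (V + h)
    have h3 : ((S.filter fun n => V + h ≤ (Q * (q * n + r) + h).primeFactors.card).card : ℝ)
        * 2 ^ (V + h) ≤ T := le_trans (by gcongr) h2
    calc _ ≤ T / 2 ^ (V + h) := by rw [le_div_iff₀ (by positivity)]; exact h3
      _ = _ := by rw [pow_add, one_div, inv_pow]; field_simp
  have hgeo : ∑ h ∈ Finset.Icc 1 X, (1 / 2 : ℝ) ^ h ≤ 1 := by
    have h1 := summable_geometric_two
    have h2 := h1.sum_le_tsum (Finset.Icc 0 X) (fun _ _ => by positivity)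
    rw [tsum_geometric_two, ← Finset.insert_Icc_succ_left_eq_Icc (Nat.zero_le X),
      Finset.sum_insert (by simp)] at h2
    simp only [pow_zero, Order.succ_eq_add_one, zero_add] at h2
    linarith
  have h1 : (S.card : ℝ) ≤ ∑ h ∈ Finset.Icc 1 X,
      ((S.filter fun n => V + h ≤ (Q * (q * n + r) + h).primeFactors.card).card : ℝ) := by
    exact_mod_cast (Finset.card_le_card hcover).trans Finset.card_biUnion_le
  have h2 : (S.card : ℝ) ≤ T / 2 ^ V := by
    refine h1.trans ((Finset.sum_le_sum hpiece).trans ?_)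
    rw [← Finset.mul_sum]
    exact mul_le_of_le_one_right (by positivity) hgeo
  rw [le_div_iff₀ (by positivity)] at h2
  linarith

lemma summable_omega (t N : ℕ) (ht : 2 ≤ t) :
    Summable (fun n : ℕ => ((n + N).primeFactors.card : ℝ) / (t : ℝ) ^ n) := by
  have ht0 : (0 : ℝ) < t := by positivity
  have hlt : ‖((t : ℝ)⁻¹)‖ < 1 := by
    rw [Real.norm_of_nonneg (by positivity)]
    exact inv_lt_one_of_one_lt₀ (by exact_mod_cast ht)
  have h1 := (hasSum_coe_mul_geometric_of_norm_lt_one hlt).summable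
  have h2 := (summable_geometric_of_norm_lt_one hlt).mul_left (N : ℝ)
  refine Summable.of_nonneg_of_le (fun _ => by positivity) (fun n => ?_) (h1.add h2)
  rw [← add_mul, inv_pow, div_eq_mul_inv]
  gcongr
  exact_mod_cast omega_le_self _

lemma irr_core (t : ℕ) (ht : 2 ≤ t)
    (hyp : ∀ h₀ : ℕ, 1 ≤ h₀ → ∃ H V N : ℕ, h₀ ≤ H ∧
      (∀ h, 1 ≤ h → h ≤ H → (N + h).primeFactors.card =
          h.primeFactors.card + 1 + if h = h₀ then 1 else 0) ∧
      (∀ h, 1 ≤ h → (N + h).primeFactors.card ≤ V + h) ∧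
      ((V : ℝ) + H + 3) / 2 ^ H < 1 / (t : ℝ) ^ h₀) :
    Irrational (∑' n : ℕ, (n.primeFactors.card : ℝ) / t ^ n) := by
  rintro ⟨y, hy⟩
  have ht0 : (0 : ℝ) < t := by positivity
  have ht2 : (2 : ℝ) ≤ t := by exact_mod_cast ht
  have htne : (t : ℝ) - 1 ≠ 0 := by linarith
  set C : ℕ := y.den * (t - 1) with hC
  have hCpos : 0 < C := Nat.mul_pos y.den_pos (by omega)
  have hCr : (C : ℝ) = y.den * ((t : ℝ) - 1) := by
    rw [hC]; push_cast [Nat.cast_sub (show 1 ≤ t by omega)]; rfl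
  have hyr : (y : ℝ) * y.den = y.num := by exact_mod_cast Rat.mul_den_eq_num y
  set h₀ := 2 * C with hh₀
  obtain ⟨H, V, N, hH, hex, hup, hsmall⟩ := hyp h₀ (by omega)
  set s : ℕ → ℝ := fun M => ∑' h : ℕ, ((h + (M + 1)).primeFactors.card : ℝ) / (t : ℝ) ^ (h + 1)
    with hs
  have hsumm : ∀ M : ℕ, Summable (fun h : ℕ =>
      ((h + (M + 1)).primeFactors.card : ℝ) / (t : ℝ) ^ (h + 1)) := by
    intro M
    refine ((summable_omega t (M + 1) ht).mul_left ((t : ℝ)⁻¹)).congr fun n => ?_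
    rw [pow_succ]; field_simp
  have hint : ∀ M : ℕ, ∃ z : ℤ, (C : ℝ) * s M = z := by
    intro M
    have h1 := (summable_omega t 0 ht).sum_add_tsum_nat_add (M + 1)
    simp only [add_zero] at h1
    rw [← hy] at h1
    have h2 : (t : ℝ) ^ M * ∑' i : ℕ, ((i + (M + 1)).primeFactors.card : ℝ) / t ^ (i + (M + 1))
        = s M := by
      rw [hs, ← tsum_mul_left]
      refine tsum_congr fun i => ?_
      rw [show i + (M + 1) = M + (i + 1) by ring, pow_add (t : ℝ) M]
      field_simp
    have h3 : (t : ℝ) ^ M * ∑ i ∈ Finset.range (M + 1), (i.primeFactors.card : ℝ) / t ^ i =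
        ((∑ i ∈ Finset.range (M + 1), i.primeFactors.card * t ^ (M - i) : ℕ) : ℝ) := by
      push_cast
      rw [Finset.mul_sum]
      refine Finset.sum_congr rfl fun i hi => ?_
      have : i ≤ M := by have := Finset.mem_range.1 hi; omega
      rw [← pow_mul_pow_sub (t : ℝ) this]
      field_simp
    refine ⟨((t : ℤ) - 1) * (t ^ M * y.num - y.den *
      ((∑ i ∈ Finset.range (M + 1), i.primeFactors.card * t ^ (M - i) : ℕ) : ℤ)), ?_⟩
    rw [Int.cast_mul, Int.cast_sub, Int.cast_sub, Int.cast_mul, Int.cast_mul, Int.cast_natCast,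
      Int.cast_natCast, Int.cast_natCast, Int.cast_pow, Int.cast_natCast, Int.cast_one, ← h3, ← h2,
      ← hyr, hCr, ← h1]
    ring
  set d : ℕ → ℝ := fun h => (((h + (N + 1)).primeFactors.card : ℝ) -
    ((h + (0 + 1)).primeFactors.card : ℝ) - 1) / (t : ℝ) ^ (h + 1) with hd
  have hgeo : HasSum (fun h : ℕ => 1 / (t : ℝ) ^ (h + 1)) (1 / ((t : ℝ) - 1)) := by
    have h1 := (hasSum_geometric_of_lt_one (r := (t : ℝ)⁻¹) (by positivity)
      (inv_lt_one_of_one_lt₀ (by linarith))).mul_left ((t : ℝ)⁻¹)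
    have e1 : (fun h : ℕ => 1 / (t : ℝ) ^ (h + 1)) = fun i => (t : ℝ)⁻¹ * (t : ℝ)⁻¹ ^ i := by
      ext h; rw [← pow_succ', inv_pow, one_div]
    have e2 : 1 / ((t : ℝ) - 1) = (t : ℝ)⁻¹ * (1 - (t : ℝ)⁻¹)⁻¹ := by
      rw [← mul_inv, mul_sub, mul_inv_cancel₀ ht0.ne', mul_one, one_div]
    rw [e1, e2]; exact h1
  have hdsum : HasSum d (s N - s 0 - 1 / ((t : ℝ) - 1)) := by
    refine (((hsumm N).hasSum.sub (hsumm 0).hasSum).sub hgeo).congr_fun ?_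
    intro h
    simp only [hd]; ring
  obtain ⟨zN, hzN⟩ := hint N
  obtain ⟨z0, hz0⟩ := hint 0
  have hDint : (C : ℝ) * (∑' h, d h) = ((zN - z0 - y.den : ℤ) : ℝ) := by
    rw [hdsum.tsum_eq]; push_cast
    rw [← hzN, ← hz0, mul_sub, mul_sub, hCr]
    field_simp
  -- split the sum
  have hsplit := hdsum.summable.sum_add_tsum_nat_add H
  have hhead : ∑ i ∈ Finset.range H, d i = 1 / (t : ℝ) ^ h₀ := by
    rw [Finset.sum_eq_single (h₀ - 1)]
    · have h1 := hex h₀ (by omega) hH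
      simp only [hd]
      rw [show h₀ - 1 + (N + 1) = N + h₀ by omega, show h₀ - 1 + (0 + 1) = h₀ by omega, h1,
        if_pos rfl]
      push_cast; ring
    · intro i hi hne
      have hi' := Finset.mem_range.1 hi
      have h1 := hex (i + 1) (by omega) (by omega)
      simp only [hd]
      rw [show i + (N + 1) = N + (i + 1) by omega, show i + (0 + 1) = i + 1 by omega, h1,
        if_neg (by omega)]
      push_cast; ring
    · intro hn; exact absurd (Finset.mem_range.2 (by omega)) hn
  have hmaj : HasSum (fun i : ℕ => (1 / (2 : ℝ) ^ (H + 1)) * (((V : ℝ) + H + 2) * (1 / 2) ^ i +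
      i * (1 / 2) ^ i)) ((1 / (2 : ℝ) ^ (H + 1)) * (((V : ℝ) + H + 2) * 2 + 2)) := by
    have g1 := hasSum_geometric_two
    have g2 := hasSum_coe_mul_geometric_of_norm_lt_one (r := (1 / 2 : ℝ))
      (by rw [Real.norm_of_nonneg] <;> norm_num)
    norm_num at g2
    have := ((g1.mul_left ((V : ℝ) + H + 2)).add (by simpa using g2)).mul_left
      (1 / (2 : ℝ) ^ (H + 1))
    simpa using this
  have htail : |∑' i, d (i + H)| ≤ ((V : ℝ) + H + 3) / 2 ^ H := by
    have h1 : ((V : ℝ) + H + 3) / 2 ^ H = (1 / (2 : ℝ) ^ (H + 1)) * (((V : ℝ) + H + 2) * 2 + 2) := by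
      rw [pow_succ]; field_simp; ring
    rw [h1, ← Real.norm_eq_abs]
    refine tsum_of_norm_bounded hmaj fun i => ?_
    simp only [hd]
    rw [Real.norm_eq_abs, abs_div, abs_of_pos (show (0 : ℝ) < (t : ℝ) ^ (i + H + 1) by positivity)]
    have u1 : ((i + H + (N + 1)).primeFactors.card : ℝ) ≤ V + (i + H + 1) := by
      have := hup (i + H + 1) (by omega)
      rw [show i + H + (N + 1) = N + (i + H + 1) by omega]
      exact_mod_cast this
    have u2 : ((i + H + (0 + 1)).primeFactors.card : ℝ) ≤ i + H + 1 := by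
      exact_mod_cast omega_le_self (i + H + (0 + 1))
    have u3 : (0 : ℝ) ≤ ((i + H + (N + 1)).primeFactors.card : ℝ) := by positivity
    have u4 : (0 : ℝ) ≤ ((i + H + (0 + 1)).primeFactors.card : ℝ) := by positivity
    have u5 : (0 : ℝ) ≤ V := by positivity
    have u6 : |((i + H + (N + 1)).primeFactors.card : ℝ) -
        ((i + H + (0 + 1)).primeFactors.card : ℝ) - 1| ≤ V + H + 2 + i := by
      rw [abs_le]; constructor <;> linarith
    calc _ ≤ ((V : ℝ) + H + 2 + i) / 2 ^ (i + H + 1) := by gcongr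
      _ = _ := by
        rw [show i + H + 1 = (H + 1) + i by ring, pow_add, one_div_pow]; field_simp
  have habs := abs_lt.1 (htail.trans_lt hsmall)
  rw [← hsplit, hhead] at hDint
  have hCr0 : (0 : ℝ) < C := by exact_mod_cast hCpos
  have hhalf : (C : ℝ) * (1 / (t : ℝ) ^ h₀) < 1 / 2 := by
    have h1 : h₀ < t ^ h₀ := Nat.lt_pow_self (by omega)
    have h2 : (2 * C : ℝ) < (t : ℝ) ^ h₀ := by rw [hh₀] at h1; exact_mod_cast h1
    rw [mul_one_div, div_lt_iff₀ (by positivity)]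
    linarith
  have hlow : (0 : ℝ) < ((zN - z0 - y.den : ℤ) : ℝ) := by
    rw [← hDint]; apply mul_pos hCr0; linarith [habs.1]
  have hhigh : ((zN - z0 - y.den : ℤ) : ℝ) < 1 := by
    rw [← hDint]
    have := mul_lt_mul_of_pos_left habs.2 hCr0
    linarith
  have l1 : 0 < zN - z0 - y.den := by exact_mod_cast hlow
  have l2 : zN - z0 - y.den < 1 := by exact_mod_cast hhigh
  omega

lemma eventually_conditions (h₀ t : ℕ) (ht : 2 ≤ t) (x₀ : ℝ) :
    ∃ H : ℕ, h₀ ≤ H ∧ 3 ≤ H ∧ x₀ ≤ Real.exp (Real.exp ((3 / 2 : ℝ) ^ H)) ∧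
      (4 + 18 * H + 4 * (H : ℝ) ^ 4 ≤ (3 / 2 : ℝ) ^ H) ∧
      (4 * H * (3 / 2 : ℝ) ^ H + H + 4) / 2 ^ H < 1 / (t : ℝ) ^ h₀ := by
  have ht0 : (0 : ℝ) < t := by positivity
  have hz : Filter.Tendsto (fun H : ℕ => (3 / 2 : ℝ) ^ H) Filter.atTop Filter.atTop :=
    tendsto_pow_atTop_atTop_of_one_lt (by norm_num)
  have e1 := ((Real.tendsto_exp_atTop.comp Real.tendsto_exp_atTop).comp hz).eventually_ge_atTop x₀
  have p4 := tendsto_pow_const_div_const_pow_of_one_lt 4 (r := (3 / 2 : ℝ)) (by norm_num)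
  have e2 := p4.eventually_lt_const (show (0 : ℝ) < 1 / 26 by norm_num)
  have q1 := tendsto_pow_const_div_const_pow_of_one_lt 1 (r := (4 / 3 : ℝ)) (by norm_num)
  have e3 := q1.eventually_lt_const (show (0 : ℝ) < (1 / (t : ℝ) ^ h₀) / 9 by positivity)
  obtain ⟨H, h1, h2, h3, h4, h5⟩ := (e1.and (e2.and (e3.and
    ((Filter.eventually_ge_atTop h₀).and (Filter.eventually_ge_atTop 3))))).exists
  have hH1 : (3 : ℝ) ≤ H := by exact_mod_cast h5
  refine ⟨H, h4, h5, h1, ?_, ?_⟩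
  · rw [div_lt_iff₀ (by positivity)] at h2
    have g1 : (H : ℝ) ≤ H ^ 4 := le_self_pow₀ (by linarith) (by norm_num)
    linarith
  · rw [pow_one, div_lt_iff₀ (by positivity)] at h3
    rw [div_lt_iff₀ (by positivity)]
    have g1 : (2 : ℝ) ^ H = (4 / 3) ^ H * (3 / 2) ^ H := by rw [← mul_pow]; norm_num
    have g2 : (1 : ℝ) ≤ (3 / 2) ^ H := one_le_pow₀ (by norm_num)
    have g3 := mul_lt_mul_of_pos_right h3 (show (0 : ℝ) < (3 / 2) ^ H by positivity)
    rw [g1]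
    nlinarith

lemma count_bound (H V P : ℕ) (R x X z c : ℝ) (hH : 3 ≤ H) (hP : 1 ≤ P) (hR : 1 ≤ R)
    (hRH : R ≤ Real.exp (9 * H)) (hPH : (P : ℝ) = 2 * H ^ 2)
    (hz : 4 + 18 * H + 4 * (H : ℝ) ^ 4 ≤ z)
    (hx : x = Real.exp (Real.exp z)) (hX1 : 1 ≤ X) (hX : X ≤ R * x) (hV : 4 * H * z ≤ V)
    (hc : (1 / 2) * (1 / 2 * (1 / (P : ℝ)) ^ P) * x / Real.exp z ^ H ≤ c) :
    2 * X * (1 + Real.log (2 * X)) < c * 2 ^ V := by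
  have hx0 : 0 < x := by rw [hx]; positivity
  have hH3 : (3 : ℝ) ≤ H := by exact_mod_cast hH
  have hz0 : 4 ≤ z := by
    have : (0 : ℝ) ≤ (H : ℝ) ^ 4 := by positivity
    linarith
  have hE : 1 ≤ Real.exp z := Real.one_le_exp (by linarith)
  have hlog : Real.log (2 * X) ≤ Real.log (2 * R) + Real.exp z := by
    have h1 : Real.log (2 * X) ≤ Real.log (2 * R * x) :=
      Real.log_le_log (by linarith) (by linarith)
    rw [Real.log_mul (by linarith) hx0.ne', hx, Real.log_exp] at h1
    exact h1
  have hlog2 : Real.log (2 * R) ≤ 2 * R - 1 := Real.log_le_sub_one_of_pos (by linarith)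
  have hlog0 : 0 ≤ Real.log (2 * X) := Real.log_nonneg (by linarith)
  have hL : 1 + Real.log (2 * X) ≤ 4 * R * Real.exp z := by nlinarith
  have hT : 2 * X * (1 + Real.log (2 * X)) ≤ 8 * R ^ 2 * x * Real.exp z := by
    calc _ ≤ 2 * (R * x) * (4 * R * Real.exp z) := by gcongr
      _ = _ := by ring
  have h2V : Real.exp (2 * H * z) ≤ 2 ^ V := by
    rw [← Real.exp_log (show (0 : ℝ) < 2 ^ V by positivity), Real.log_pow]
    apply Real.exp_le_exp.2
    have := Real.log_two_gt_d9
    have hV0 : 0 ≤ 4 * H * z := by positivity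
    nlinarith
  have hPP : ((P : ℝ)) ^ P ≤ Real.exp (4 * (H : ℝ) ^ 4) := by
    have h1 : (P : ℝ) ≤ Real.exp P := by linarith [Real.add_one_le_exp (P : ℝ)]
    calc (P : ℝ) ^ P ≤ Real.exp P ^ P := by gcongr
      _ = Real.exp (P * P) := by rw [← Real.exp_nat_mul]
      _ = _ := by rw [hPH]; ring_nf
  have h32 : (32 : ℝ) ≤ Real.exp 4 := by
    have h1 := Real.exp_one_gt_d9
    have h2 : Real.exp 4 = Real.exp 1 ^ 4 := by rw [← Real.exp_nat_mul]; norm_num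
    rw [h2]
    calc (32 : ℝ) ≤ 2.7 ^ 4 := by norm_num
      _ ≤ _ := by gcongr; linarith
  have hmain : 32 * R ^ 2 * (P : ℝ) ^ P ≤ Real.exp z := by
    calc 32 * R ^ 2 * (P : ℝ) ^ P ≤ Real.exp 4 * Real.exp (9 * H) ^ 2 * Real.exp (4 * (H : ℝ) ^ 4) := by
          gcongr
      _ = Real.exp (4 + 18 * H + 4 * (H : ℝ) ^ 4) := by
          rw [← Real.exp_nat_mul, ← Real.exp_add, ← Real.exp_add]; congr 1; push_cast; ring
      _ ≤ _ := Real.exp_le_exp.2 hz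
  have hPr : (0 : ℝ) < (P : ℝ) ^ P := by positivity
  have hc' : x * Real.exp (H * z) / (4 * (P : ℝ) ^ P) ≤ c * 2 ^ V := by
    have h1 : x * Real.exp (H * z) / (4 * (P : ℝ) ^ P) =
        ((1 / 2) * (1 / 2 * (1 / (P : ℝ)) ^ P) * x / Real.exp z ^ H) * Real.exp (2 * H * z) := by
      rw [← Real.exp_nat_mul, show 2 * (H : ℝ) * z = H * z + H * z by ring, Real.exp_add, one_div_pow]
      field_simp
      norm_num
    rw [h1]
    have h0 : 0 ≤ (1 / 2) * (1 / 2 * (1 / (P : ℝ)) ^ P) * x / Real.exp z ^ H := by positivity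
    exact mul_le_mul hc h2V (by positivity) (h0.trans hc)
  refine lt_of_le_of_lt hT (lt_of_lt_of_le ?_ hc')
  rw [lt_div_iff₀ (by positivity)]
  calc 8 * R ^ 2 * x * Real.exp z * (4 * (P : ℝ) ^ P)
      = x * Real.exp z * (32 * R ^ 2 * (P : ℝ) ^ P) := by ring
    _ ≤ x * Real.exp z * Real.exp z := by gcongr
    _ = x * Real.exp (2 * z) := by rw [mul_assoc, ← Real.exp_add]; ring_nf
    _ < x * Real.exp (H * z) := by
        apply mul_lt_mul_of_pos_left _ hx0
        apply Real.exp_lt_exp.2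
        nlinarith


theorem omega_series_irrational
    (hHL : ∀ ε : ℝ, 0 < ε → ∃ x₀ : ℝ, ∀ x : ℝ, x₀ ≤ x →
      ∀ (K : ℕ) (a b : Fin K → ℕ),
        (∀ k, 0 < a k) → (∀ k, 0 < b k) →
        Function.Injective (fun k => (a k, b k)) →
        (∀ p : ℕ, p.Prime →
          {n : ZMod p | ∏ k, ((a k : ZMod p) * n + (b k : ZMod p)) = 0}.ncard < p) →
        (∀ k, (a k : ℝ) ≤ (Real.log (Real.log x)) ^ 100) →
        (∀ k, (b k : ℝ) ≤ (Real.log (Real.log x)) ^ 100) →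
        (K : ℝ) ≤ 100 * Real.log (Real.log (Real.log x)) →
        |((((Finset.Icc 1 ⌊x⌋₊).filter fun n => ∀ k, Nat.Prime (a k * n + b k)).card : ℝ) -
            (∏' p : {p : ℕ // p.Prime},
              (1 - ({n : ZMod (p : ℕ) |
                  ∏ k, ((a k : ZMod (p : ℕ)) * n + (b k : ZMod (p : ℕ))) = 0}.ncard : ℝ) / (p : ℕ)) *
                ((1 - 1 / ((p : ℕ) : ℝ))⁻¹) ^ K) * x / (Real.log x) ^ K)|
          ≤ ε * ((∏' p : {p : ℕ // p.Prime},
              (1 - ({n : ZMod (p : ℕ) |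
                  ∏ k, ((a k : ZMod (p : ℕ)) * n + (b k : ZMod (p : ℕ))) = 0}.ncard : ℝ) / (p : ℕ)) *
                ((1 - 1 / ((p : ℕ) : ℝ))⁻¹) ^ K) * x / (Real.log x) ^ K)) :
    ∀ t : ℕ, 2 ≤ t → Irrational (∑' n : ℕ, (n.primeFactors.card : ℝ) / t ^ n) := by

  intro t ht
  apply irr_core t ht
  intro h₀ hh₀
  obtain ⟨x₀, hx₀⟩ := hHL (1 / 2) (by norm_num)
  obtain ⟨H, hH0, hH3, hxx, hz, hsmall⟩ := eventually_conditions h₀ t ht x₀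
  obtain ⟨Q, q, r, a, b, hQ, hq, hQle, hq2, hr, ha, hb, hinj, hadm, hale, hble, hω⟩ :=
    construction H h₀ hh₀ hH0
  set z : ℝ := (3 / 2 : ℝ) ^ H with hzdef
  set x : ℝ := Real.exp (Real.exp z) with hxdef
  have hH3r : (3 : ℝ) ≤ H := by exact_mod_cast hH3
  set R : ℝ := ((Q * (q + r) : ℕ) : ℝ) with hR
  have hR1 : 1 ≤ R := by
    rw [hR]
    have : 1 ≤ Q * (q + r) := Nat.mul_pos hQ (by omega)
    exact_mod_cast this
  have hRH : R ≤ Real.exp (9 * H) := by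
    have h1 : q + r ≤ 8 * H ^ 2 := by nlinarith
    have h2 : ((q + r : ℕ) : ℝ) ≤ 8 * (H : ℝ) ^ 2 := by exact_mod_cast h1
    have h3 : (H : ℝ) ≤ Real.exp H := by linarith [Real.add_one_le_exp (H : ℝ)]
    have h4 : (8 : ℝ) ≤ Real.exp H := by
      have e1 := Real.exp_one_gt_d9
      have e2 : Real.exp 3 = Real.exp 1 ^ 3 := by rw [← Real.exp_nat_mul]; norm_num
      calc (8 : ℝ) ≤ 2 ^ 3 := by norm_num
        _ ≤ Real.exp 1 ^ 3 := by gcongr; linarith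
        _ = Real.exp 3 := e2.symm
        _ ≤ _ := Real.exp_le_exp.2 hH3r
    calc R = (Q : ℝ) * ((q + r : ℕ) : ℝ) := by rw [hR]; push_cast; ring
      _ ≤ Real.exp (6 * H) * (8 * (H : ℝ) ^ 2) := by gcongr
      _ ≤ Real.exp (6 * H) * (Real.exp H * Real.exp H ^ 2) := by gcongr
      _ = _ := by rw [← Real.exp_nat_mul, ← Real.exp_add, ← Real.exp_add]; congr 1; push_cast; ring
  have hRz : R ≤ z ^ 100 := by
    refine hRH.trans ?_
    rw [hzdef, ← pow_mul, mul_comm H 100, pow_mul, show (9 : ℝ) * H = H * 9 by ring,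
      Real.exp_nat_mul]
    apply pow_le_pow_left₀ (Real.exp_pos _).le
    have e1 := Real.exp_one_lt_d9
    have e2 : Real.exp 9 = Real.exp 1 ^ 9 := by rw [← Real.exp_nat_mul]; norm_num
    rw [e2]
    calc Real.exp 1 ^ 9 ≤ 3 ^ 9 := by gcongr; linarith
      _ ≤ _ := by norm_num
  have hlog1 : Real.log x = Real.exp z := Real.log_exp _
  have hlog2 : Real.log (Real.log x) = z := by rw [hlog1, Real.log_exp]
  have hlog3 : (H : ℝ) ≤ 100 * Real.log (Real.log (Real.log x)) := by
    rw [hlog2, hzdef, Real.log_pow]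
    have := Real.one_sub_inv_le_log_of_pos (show (0 : ℝ) < 3 / 2 by norm_num)
    norm_num at this
    nlinarith
  have hcount := hx₀ x hxx H a b ha hb hinj hadm
    (fun k => by rw [hlog2]; exact le_trans (by rw [hR]; exact_mod_cast hale k) hRz)
    (fun k => by rw [hlog2]; exact le_trans (by rw [hR]; exact_mod_cast hble k) hRz) hlog3
  have hsing := singular_tprod H (by omega)
    (fun p => {n : ZMod p | ∏ k, ((a k : ZMod p) * n + (b k : ZMod p)) = 0}.ncard) hadm
    (fun p hp => root_count_le hp a b (hadm p hp))
  rw [hlog1] at hcount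
  have hx0 : 0 < x := Real.exp_pos _
  set S := (Finset.Icc 1 ⌊x⌋₊).filter fun n => ∀ k, Nat.Prime (a k * n + b k) with hS
  set G := ∏' p : {p : ℕ // p.Prime},
              (1 - ({n : ZMod (p : ℕ) |
                  ∏ k, ((a k : ZMod (p : ℕ)) * n + (b k : ZMod (p : ℕ))) = 0}.ncard : ℝ) / (p : ℕ)) *
                ((1 - 1 / ((p : ℕ) : ℝ))⁻¹) ^ H with hG
  set P := 2 * H ^ 2 with hP
  have hScard : (1 / 2) * (1 / 2 * (1 / (P : ℝ)) ^ P) * x / Real.exp z ^ H ≤ (S.card : ℝ) := by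
    have h1 := (abs_le.1 hcount).1
    have h2 : (1 / 2) * (1 / 2 * (1 / (P : ℝ)) ^ P) * x / Real.exp z ^ H ≤
        (1 / 2) * G * x / Real.exp z ^ H := by gcongr
    have h3 : (1 / 2) * G * x / Real.exp z ^ H = 1 / 2 * (G * x / Real.exp z ^ H) := by ring
    linarith
  have hx1 : 1 ≤ x := Real.one_le_exp (Real.exp_pos _).le
  have hfl : (⌊x⌋₊ : ℝ) ≤ x := Nat.floor_le hx0.le
  have hfl1 : 1 ≤ ⌊x⌋₊ := Nat.le_floor (by exact_mod_cast hx1)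
  have hz0 : 0 < z := by positivity
  set V := ⌈4 * H * z⌉₊ with hV
  have hVle : (V : ℝ) ≤ 4 * H * z + 1 := (Nat.ceil_lt_add_one (by positivity)).le
  have hXx : ((Q * (q * ⌊x⌋₊ + r) : ℕ) : ℝ) ≤ R * x := by
    rw [hR]; push_cast
    have h1 : (r : ℝ) ≤ r * x := le_mul_of_one_le_right (by positivity) hx1
    calc (Q : ℝ) * (q * (⌊x⌋₊ : ℝ) + r) ≤ Q * (q * x + r * x) := by gcongr
      _ = _ := by ring
  have hX1 : (1 : ℝ) ≤ ((Q * (q * ⌊x⌋₊ + r) : ℕ) : ℝ) := by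
    have h1 : 1 ≤ q * ⌊x⌋₊ := Nat.mul_pos hq hfl1
    have : 1 ≤ Q * (q * ⌊x⌋₊ + r) := Nat.mul_pos hQ (by omega)
    exact_mod_cast this
  have hbound := count_bound H V P R x _ z S.card hH3 (by nlinarith) hR1 hRH
    (by rw [hP]; push_cast; ring) hz rfl hX1 hXx (Nat.le_ceil _) hScard
  obtain ⟨n, hnS, hn⟩ := good_of_count ⌊x⌋₊ Q q r V S (Finset.filter_subset _ _) hQ hq
    (by rw [Nat.cast_mul 2]; exact hbound)
  have hnS' := Finset.mem_filter.1 hnS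
  refine ⟨H, V, Q * (q * n + r), hH0, ?_, hn, ?_⟩
  · exact hω n (Finset.mem_Icc.1 hnS'.1).1 hnS'.2
  · refine lt_of_le_of_lt ?_ hsmall
    exact div_le_div_of_nonneg_right (by linarith) (by positivity)
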